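/- Let 0 < η ≤ 1, 0 < d < 1, and N > 0 be real numbers, and let (uᵢ)_{i≥0} be a sequence of nonnegative reals with u₀ ≤ 1 and uᵢ ≤ i(1 − η)^{i−1} for all i ≥ 1. Then Σ_{k=1}^∞ e^{−N} (N^k / k!) · k · Σ_{i=0}^{k−1} C(k−1, i) d^i (1 − d)^{k−1−i} uᵢ ≤ N e^{−dN} + dN² e^{−η dN} = dN² e^{−η dN} (1 + (1/(dN)) e^{−(1−η) dN}). -/

import Mathlib

open Real Finset

/-- The expectation of `i * x ^ (i - 1)` over binomial weights: the derivative in `x` of the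
binomial expansion of `(a * x + b) ^ k`. -/
theorem sum_choose_mul_deriv_pow (a b x : ℝ) (k : ℕ) :
    ∑ i ∈ Finset.range (k + 1),
        (Nat.choose k i : ℝ) * a ^ i * b ^ (k - i) * ((i : ℝ) * x ^ (i - 1))
      = k * a * (a * x + b) ^ (k - 1) := by
  cases k with
  | zero => simp
  | succ n =>
    rw [Finset.sum_range_succ', Nat.add_sub_cancel, add_pow, Finset.mul_sum]
    simp only [Nat.cast_zero, zero_mul, mul_zero, add_zero]
    refine Finset.sum_congr rfl fun i _ => ?_
    have h : ((n : ℝ) + 1) * (Nat.choose n i : ℝ)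
        = (Nat.choose (n + 1) (i + 1) : ℝ) * ((i : ℝ) + 1) := by
      exact_mod_cast Nat.add_one_mul_choose_eq n i
    rw [Nat.add_sub_add_right, Nat.add_sub_cancel, mul_pow]
    push_cast
    linear_combination (-(a ^ (i + 1) * b ^ (n - i) * x ^ i)) * h

/-- A binomial average of `u` is at most the contribution of `i = 0` plus the average of the
bound on the other terms. -/
theorem sum_choose_mul_le {η d : ℝ} (hd0 : 0 ≤ d) (hd1 : d ≤ 1) {u : ℕ → ℝ} (hu0 : u 0 ≤ 1)
    (hu : ∀ i : ℕ, 1 ≤ i → u i ≤ (i : ℝ) * (1 - η) ^ (i - 1)) (k : ℕ) :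
    ∑ i ∈ Finset.range (k + 1), (Nat.choose k i : ℝ) * d ^ i * (1 - d) ^ (k - i) * u i
      ≤ (1 - d) ^ k + k * d * (1 - η * d) ^ (k - 1) := by
  have hb : 0 ≤ 1 - d := sub_nonneg.2 hd1
  have h := sum_choose_mul_deriv_pow d (1 - d) (1 - η) k
  rw [show d * (1 - η) + (1 - d) = 1 - η * d by ring] at h
  rw [← h, Finset.sum_range_succ', Finset.sum_range_succ' _ k, add_comm]
  simp only [Nat.choose_zero_right, Nat.cast_one, pow_zero, one_mul, Nat.sub_zero, Nat.cast_zero,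
    zero_mul, mul_zero, add_zero]
  refine add_le_add (mul_le_of_le_one_right (pow_nonneg hb k) hu0)
    (Finset.sum_le_sum fun i _ => ?_)
  exact mul_le_mul_of_nonneg_left (hu (i + 1) (Nat.le_add_left 1 i)) (by positivity)

theorem hasSum_pow_div_factorial (x : ℝ) :
    HasSum (fun k : ℕ => x ^ k / (Nat.factorial k : ℝ)) (Real.exp x) := by
  rw [Real.exp_eq_exp_ℝ]
  exact NormedSpace.expSeries_div_hasSum_exp x

theorem hasSum_mul_pow_pred_div_factorial (N x : ℝ) :
    HasSum (fun k : ℕ => N ^ k / (Nat.factorial k : ℝ) * (k * x ^ (k - 1)))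
      (N * Real.exp (N * x)) := by
  rw [← hasSum_nat_add_iff' 1]
  simp only [Finset.sum_range_one, Nat.cast_zero, zero_mul, mul_zero, sub_zero]
  refine ((hasSum_pow_div_factorial (N * x)).mul_left N).congr_fun fun k => ?_
  rw [Nat.add_sub_cancel, Nat.factorial_succ, mul_pow]
  push_cast
  field_simp
  ring

/-- The bound `σ'(N) ≤ N e^{-dN} + dN² e^{-ηdN}` on the probability that some interior
node has an empty `η`disk, together with the product-form identity for the bound. -/
theorem interior_empty_disk_bound (η d N : ℝ) (hη0 : 0 < η) (hη1 : η ≤ 1)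
    (hd0 : 0 < d) (hd1 : d < 1) (hN : 0 < N)
    (u : ℕ → ℝ) (hu_nonneg : ∀ i, 0 ≤ u i) (hu0 : u 0 ≤ 1)
    (hu : ∀ i : ℕ, 1 ≤ i → u i ≤ (i : ℝ) * (1 - η) ^ (i - 1)) :
    (∑' k : ℕ, Real.exp (-N) * N ^ (k + 1) / (Nat.factorial (k + 1)) * (k + 1) *
        ∑ i ∈ Finset.range (k + 1),
          (Nat.choose k i : ℝ) * d ^ i * (1 - d) ^ (k - i) * u i)
      ≤ N * Real.exp (-d * N) + d * N ^ 2 * Real.exp (-η * d * N) ∧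
    N * Real.exp (-d * N) + d * N ^ 2 * Real.exp (-η * d * N)
      = d * N ^ 2 * Real.exp (-η * d * N)
        * (1 + 1 / (d * N) * Real.exp (-(1 - η) * d * N)) := by
  have hd : 0 ≤ 1 - d := by linarith
  constructor
  · have hS : HasSum (fun k : ℕ => Real.exp (-N) * N ^ (k + 1) / (Nat.factorial (k + 1)) * (k + 1) *
        ((1 - d) ^ k + k * d * (1 - η * d) ^ (k - 1)))
        (N * Real.exp (-d * N) + d * N ^ 2 * Real.exp (-η * d * N)) := by
      have h := ((hasSum_pow_div_factorial (N * (1 - d))).mul_left (N * Real.exp (-N))).add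
        ((hasSum_mul_pow_pred_div_factorial N (1 - η * d)).mul_left (N * Real.exp (-N) * d))
      rw [show -d * N = -N + N * (1 - d) by ring,
        show -η * d * N = -N + N * (1 - η * d) by ring, Real.exp_add, Real.exp_add,
        show ∀ p q r : ℝ, N * (p * q) + d * N ^ 2 * (p * r) = N * p * q + N * p * d * (N * r) by
          intros; ring]
      refine h.congr_fun fun k => ?_
      rw [Nat.factorial_succ, mul_pow]
      push_cast
      field_simp
      ring
    have hle : ∀ k : ℕ, Real.exp (-N) * N ^ (k + 1) / (Nat.factorial (k + 1)) * (k + 1) *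
        ∑ i ∈ Finset.range (k + 1), (Nat.choose k i : ℝ) * d ^ i * (1 - d) ^ (k - i) * u i
        ≤ Real.exp (-N) * N ^ (k + 1) / (Nat.factorial (k + 1)) * (k + 1) *
        ((1 - d) ^ k + k * d * (1 - η * d) ^ (k - 1)) := fun k =>
      mul_le_mul_of_nonneg_left (sum_choose_mul_le hd0.le hd1.le hu0 hu k) (by positivity)
    refine hasSum_le hle (Summable.of_nonneg_of_le (fun k => ?_) hle hS.summable).hasSum hS
    exact mul_nonneg (by positivity) (Finset.sum_nonneg fun i _ =>
      mul_nonneg (by positivity) (hu_nonneg i))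
  · rw [show -d * N = -η * d * N + -(1 - η) * d * N by ring, Real.exp_add]
    field_simp
    ring
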